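/- arXiv:1602.01490 — 14 statements merged into one kernel-verified Lean document; each statement's English description precedes it below -/
import Mathlib

section
/- Let v = (v₀, v₁, v₂) ∈ ℝ³ with v₂ < 0 be the velocity of the disk immediately after a collision at a point q⁻ on the upper wall {x₂ = 1}, normalized so that the next collision on the lower wall {x₂ = 0} occurs at the origin; thus q⁻ = (v₀/v₂, v₁/v₂, 1), and the next upper-wall collision point is q⁺ = (−1/v₂)·(T·v), where T·v is the matrix–vector product. Then (q⁺)₁ − (q⁻)₁ = √2 · ((q⁺)₀ − (q⁻)₀); that is, consecutive collision points on the same wall lie on a line of slope √2 in the (x₀, x₁)-plane. -/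
open Real Matrix

/-- The no-slip collision matrix `T` for a wall with inward unit normal `e₂`. -/
noncomputable def noslipT : Matrix (Fin 3) (Fin 3) ℝ :=
  !![-1/3, 2 * Real.sqrt 2 / 3, 0;
     2 * Real.sqrt 2 / 3, 1/3, 0;
     0, 0, -1]

/-- Consecutive collision points on the same wall of the no-slip strip billiard
lie on a line of slope `√2` in the `(x₀, x₁)`-plane. -/
theorem noslip_strip_contact_line (v : Fin 3 → ℝ) (hv2 : v 2 < 0)
    (qm qp : Fin 3 → ℝ)
    (hqm : qm = ![v 0 / v 2, v 1 / v 2, 1])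
    (hqp : qp = (-1 / v 2) • (noslipT.mulVec v)) :
    qp 1 - qm 1 = Real.sqrt 2 * (qp 0 - qm 0) := by
  have h2 : Real.sqrt 2 * Real.sqrt 2 = 2 := Real.mul_self_sqrt (by norm_num)
  have hv : v 2 ≠ 0 := hv2.ne
  subst hqm hqp
  simp only [noslipT, Matrix.mulVec, dotProduct, Fin.sum_univ_three, Pi.smul_apply, smul_eq_mul,
    Matrix.of_apply, Matrix.cons_val]
  field_simp
  linear_combination 2 * v 1 * h2
end

section
/- For every integer n ≥ 1 and every v = (v₀, v₁, v₂) ∈ ℝ³, if Sⁿ·v = v then v₀ = 0 and v₁ = 0. In particular Sⁿ ≠ 1 for all n ≥ 1, so the no-slip strip billiard has no periodic orbits other than the trivial period-two orbits with purely vertical velocity. -/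
open Real Matrix

/-- The two-collision velocity map `S` of the no-slip strip billiard. -/
noncomputable def noslipS : Matrix (Fin 3) (Fin 3) ℝ :=
  !![-7/9, -4 * Real.sqrt 2 / 9, 0;
     4 * Real.sqrt 2 / 9, -7/9, 0;
     0, 0, 1]

/-- The upper-left block of `noslipS ^ n` is multiplication by `(a + b √-2) / 9 ^ n`, where the
integers `a` and `b` are both nonzero modulo `3` once `1 ≤ n`. -/
lemma noslipS_pow_eq (n : ℕ) (hn : 1 ≤ n) :
    ∃ a b : ℤ, a % 3 = 2 ∧ b % 3 = 1 ∧ noslipS ^ n =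
      !![(a : ℝ) / 9 ^ n, -(b * √2) / 9 ^ n, 0;
         b * √2 / 9 ^ n, a / 9 ^ n, 0;
         0, 0, 1] := by
  induction n, hn using Nat.le_induction with
  | base =>
    refine ⟨-7, 4, by norm_num, by norm_num, ?_⟩
    rw [pow_one, noslipS]
    ext i j
    fin_cases i <;> fin_cases j <;> simp
  | succ n hn ih =>
    obtain ⟨a, b, ha, hb, h⟩ := ih
    refine ⟨-7 * a - 8 * b, 4 * a - 7 * b, by omega, by omega, ?_⟩
    have hsqrt : √2 ^ 2 = (2 : ℝ) := Real.sq_sqrt (by norm_num)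
    rw [pow_succ, h, noslipS]
    ext i j
    fin_cases i <;> fin_cases j <;>
      simp [Matrix.mul_apply, Fin.sum_univ_three] <;> field_simp <;>
      ring_nf <;> (try rw [hsqrt]) <;> ring

/-- The no-slip strip billiard has no periodic orbits other than the trivial
period-two orbits: any velocity fixed by `Sⁿ` (`n ≥ 1`) is purely vertical,
and in particular `Sⁿ ≠ 1`. -/
theorem noslip_strip_no_periodic (n : ℕ) (hn : 1 ≤ n) :
    (∀ v : Fin 3 → ℝ, (noslipS ^ n).mulVec v = v → v 0 = 0 ∧ v 1 = 0) ∧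
      noslipS ^ n ≠ 1 := by
  have fixed : ∀ v : Fin 3 → ℝ, (noslipS ^ n).mulVec v = v → v 0 = 0 ∧ v 1 = 0 := by
    intro v hv
    obtain ⟨a, b, -, hb, h⟩ := noslipS_pow_eq n hn
    have hb0 : (b : ℝ) ≠ 0 := by
      have : b ≠ 0 := by omega
      exact_mod_cast this
    rw [h] at hv
    have h0 := congrFun hv 0
    have h1 := congrFun hv 1
    simp only [Matrix.mulVec, dotProduct, Fin.sum_univ_three, Matrix.of_apply,
      Matrix.cons_val] at h0 h1
    set p : ℝ := a / 9 ^ n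
    set q : ℝ := b * √2 / 9 ^ n with hq
    have hq0 : q ≠ 0 := by positivity
    rw [neg_div, ← hq] at h0
    have hdet : (p - 1) ^ 2 + q ^ 2 ≠ 0 := by positivity
    constructor <;> apply (mul_eq_zero_iff_left hdet).mp
    · linear_combination (p - 1) * h0 + q * h1
    · linear_combination (p - 1) * h1 - q * h0
  refine ⟨fixed, fun h => ?_⟩
  simpa using (fixed ![1, 0, 0] (by rw [h, Matrix.one_mulVec])).1
end

section
/- The angle arccos(7/9) is not a rational multiple of π; that is, there is no rational number q with arccos(7/9) = q·π. -/
open Real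

/-- The rotation angle `arccos(7/9)` of the two-collision velocity map of the
no-slip strip billiard is not a rational multiple of `π`. -/
theorem arccos_seven_ninths_irrational_multiple_of_pi :
    ¬ ∃ q : ℚ, Real.arccos (7/9) = (q : ℝ) * Real.pi := by
  intro hq
  have hcos : Real.cos (Real.arccos (7/9)) = 7/9 :=
    Real.cos_arccos (by norm_num) (by norm_num)
  have hmem := niven hq ⟨7/9, by rw [hcos]; norm_num⟩
  rw [hcos] at hmem
  norm_num at hmem
end

section
/- Let v = (v₀, v₁, v₂) ∈ ℝ³ with v₀² + v₁² ≠ 0. Then the closure in ℝ³ of the forward orbit {Sⁿ·v : n ∈ ℕ} equals the circle {w = (w₀, w₁, w₂) ∈ ℝ³ : w₂ = v₂ and w₀² + w₁² = v₀² + v₁²}. In particular the velocity orbit of any nontrivial trajectory of the no-slip strip billiard is dense in this circle, so the displacement bound √((3/2)(1/(ẋ₂)² − 1)) is optimal. -/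
open Real Matrix

/-- The unit complex number by which `noslipS` acts on the plane of the first two coordinates. -/
noncomputable def noslipRotation : Circle :=
  ⟨⟨-7 / 9, 4 * √2 / 9⟩, mem_sphere_zero_iff_norm.2 <| by
    have h : √2 * √2 = 2 := Real.mul_self_sqrt (by norm_num)
    rw [← sq_eq_sq₀ (norm_nonneg _) zero_le_one, Complex.sq_norm, Complex.normSq_mk]
    linear_combination (16 / 81) * h⟩

theorem noslipRotation_re : (noslipRotation : ℂ).re = -7 / 9 := rfl

theorem noslipRotation_im : (noslipRotation : ℂ).im = 4 * √2 / 9 := rfl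

/-- The powers of `9 * noslipRotation = -7 + 4√-2` lie in `ℤ[√-2]`, and are constant modulo `3`. -/
theorem exists_int_noslipRotation_pow_succ (n : ℕ) :
    ∃ a b : ℤ, a % 3 = 2 ∧ b % 3 = 1 ∧
      9 ^ (n + 1) * ((noslipRotation : ℂ) ^ (n + 1)).re = a ∧
      9 ^ (n + 1) * ((noslipRotation : ℂ) ^ (n + 1)).im = b * √2 := by
  induction n with
  | zero =>
    refine ⟨-7, 4, by norm_num, by norm_num, ?_, ?_⟩ <;>
      simp only [zero_add, pow_one, noslipRotation_re, noslipRotation_im] <;> push_cast <;> ring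
  | succ n ih =>
    obtain ⟨a, b, ha, hb, hre, him⟩ := ih
    have h : √2 * √2 = 2 := Real.mul_self_sqrt (by norm_num)
    refine ⟨-7 * a - 8 * b, 4 * a - 7 * b, by omega, by omega, ?_, ?_⟩
    · rw [pow_succ _ (n + 1), pow_succ _ (n + 1), Complex.mul_re, noslipRotation_re,
        noslipRotation_im]
      push_cast
      linear_combination (-7) * hre - 4 * √2 * him - 4 * b * h
    · rw [pow_succ _ (n + 1), pow_succ _ (n + 1), Complex.mul_im, noslipRotation_re,
        noslipRotation_im]
      push_cast
      linear_combination 4 * √2 * hre - 7 * him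

theorem noslipRotation_pow_succ_ne_one (n : ℕ) : noslipRotation ^ (n + 1) ≠ 1 := by
  intro h
  obtain ⟨a, b, -, hb, -, him⟩ := exists_int_noslipRotation_pow_succ n
  rw [← Circle.coe_pow, h, Circle.coe_one, Complex.one_im, mul_zero, eq_comm, mul_eq_zero] at him
  rcases him with hb' | h2
  · rw [Int.cast_eq_zero] at hb'
    omega
  · exact (Real.sqrt_pos.2 two_pos).ne' h2

theorem Circle.denseRange_pow {z : Circle} (hz : ∀ n : ℕ, z ^ (n + 1) ≠ 1) :
    DenseRange (z ^ · : ℕ → Circle) := by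
  have : Fact (0 < 2 * π) := ⟨Real.two_pi_pos⟩
  let e := AddCircle.homeomorphCircle Real.two_pi_pos.ne'
  obtain ⟨a, rfl⟩ := e.surjective z
  have ha : addOrderOf a = 0 := by
    rw [addOrderOf_eq_zero_iff']
    intro n hn h
    obtain ⟨k, rfl⟩ := Nat.exists_eq_succ_of_ne_zero hn.ne'
    apply hz k
    rw [AddCircle.homeomorphCircle_apply, ← AddCircle.toCircle_nsmul, h, AddCircle.toCircle_zero]
  have hd := e.surjective.denseRange.comp (AddCircle.denseRange_zsmul_iff.2 ha) e.continuous
  rw [← denseRange_zpow_iff_pow]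
  convert hd using 2 with n
  simp only [e, AddCircle.homeomorphCircle_apply, Function.comp_apply, AddCircle.toCircle_zsmul]

/-- The action of the unit circle on `ℝ³` by rotations fixing the last coordinate, applied
to `v`. -/
def rotateFirstTwo (v : Fin 3 → ℝ) (p : Circle) : Fin 3 → ℝ :=
  ![((p : ℂ) * ⟨v 0, v 1⟩).re, ((p : ℂ) * ⟨v 0, v 1⟩).im, v 2]

theorem continuous_rotateFirstTwo (v : Fin 3 → ℝ) : Continuous (rotateFirstTwo v) := by
  refine continuous_pi fun i ↦ ?_
  fin_cases i <;> simp only [rotateFirstTwo] <;> dsimp <;> fun_prop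

theorem noslipS_pow_mulVec (v : Fin 3 → ℝ) (n : ℕ) :
    (noslipS ^ n).mulVec v = rotateFirstTwo v (noslipRotation ^ n) := by
  induction n with
  | zero => ext i; fin_cases i <;> simp [rotateFirstTwo]
  | succ n ih =>
    rw [pow_succ', ← Matrix.mulVec_mulVec, ih, pow_succ']
    ext i
    fin_cases i <;>
      simp [rotateFirstTwo, noslipS, Matrix.mulVec, dotProduct, Fin.sum_univ_three,
        noslipRotation_re, noslipRotation_im] <;> ring

theorem range_rotateFirstTwo (v : Fin 3 → ℝ) (hv : v 0 ^ 2 + v 1 ^ 2 ≠ 0) :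
    Set.range (rotateFirstTwo v) =
      {w : Fin 3 → ℝ | w 2 = v 2 ∧ w 0 ^ 2 + w 1 ^ 2 = v 0 ^ 2 + v 1 ^ 2} := by
  ext w
  constructor
  · rintro ⟨p, rfl⟩
    refine ⟨rfl, ?_⟩
    have hp := Circle.normSq_coe p
    rw [Complex.normSq_apply] at hp
    simp only [rotateFirstTwo, Matrix.cons_val_zero, Matrix.cons_val_one, Complex.mul_re,
      Complex.mul_im]
    linear_combination (v 0 ^ 2 + v 1 ^ 2) * hp
  · rintro ⟨h2, h⟩
    have hc : (⟨v 0, v 1⟩ : ℂ) ≠ 0 := by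
      intro h0
      obtain ⟨h0, h1⟩ := Complex.ext_iff.1 h0
      exact hv (by simp_all)
    have hn : ‖(⟨w 0, w 1⟩ : ℂ)‖ = ‖(⟨v 0, v 1⟩ : ℂ)‖ := by
      rw [← sq_eq_sq₀ (norm_nonneg _) (norm_nonneg _), Complex.sq_norm, Complex.sq_norm,
        Complex.normSq_mk, Complex.normSq_mk]
      linear_combination h
    refine ⟨⟨⟨w 0, w 1⟩ / ⟨v 0, v 1⟩, mem_sphere_zero_iff_norm.2 ?_⟩, ?_⟩
    · rw [norm_div, hn, div_self (norm_ne_zero_iff.2 hc)]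
    · ext i
      fin_cases i <;>
        simp [rotateFirstTwo, div_mul_cancel₀ _ hc, h2, -Complex.mul_re, -Complex.mul_im]

/-- The velocity orbit of any nontrivial trajectory of the no-slip strip
billiard is dense in the circle `{w : w₂ = v₂, w₀² + w₁² = v₀² + v₁²}`. -/
theorem noslip_strip_velocity_orbit_dense (v : Fin 3 → ℝ)
    (hv : v 0 ^ 2 + v 1 ^ 2 ≠ 0) :
    closure {w : Fin 3 → ℝ | ∃ n : ℕ, w = (noslipS ^ n).mulVec v} =
      {w : Fin 3 → ℝ | w 2 = v 2 ∧ w 0 ^ 2 + w 1 ^ 2 = v 0 ^ 2 + v 1 ^ 2} := by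
  have horbit : {w : Fin 3 → ℝ | ∃ n : ℕ, w = (noslipS ^ n).mulVec v} =
      rotateFirstTwo v '' Set.range (noslipRotation ^ · : ℕ → Circle) := by
    ext w
    simp [noslipS_pow_mulVec, eq_comm]
  have hcont := continuous_rotateFirstTwo v
  rw [horbit, hcont.isClosedMap.closure_image_eq_of_continuous hcont,
    (Circle.denseRange_pow noslipRotation_pow_succ_ne_one).closure_range, Set.image_univ,
    range_rotateFirstTwo v hv]
end

section
/- Let θ ∈ (0, π). For every v = (v₀, v₁, v₂) ∈ ℝ³, one has S_θ·v = v if and only if v₂ = 0 and v₀ = −√2·sin(θ/2)·v₁. That is, the fixed vectors of the two-collision velocity map of the angle-θ no-slip wedge are exactly the multiples of the axis of periodicity (−√2 sin(θ/2), 1, 0). -/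
open Real Matrix

/-- Rotation of the spatial `(x₁, x₂)`-plane by angle `φ`, fixing `x₀`. -/
noncomputable def rotMat (φ : ℝ) : Matrix (Fin 3) (Fin 3) ℝ :=
  !![1, 0, 0;
     0, Real.cos φ, -Real.sin φ;
     0, Real.sin φ, Real.cos φ]

/-- Collision map at the first wall of the angle-`θ` wedge. -/
noncomputable def Aplus (θ : ℝ) : Matrix (Fin 3) (Fin 3) ℝ :=
  rotMat ((Real.pi - θ) / 2) * noslipT * rotMat (-((Real.pi - θ) / 2))

/-- Collision map at the second wall of the angle-`θ` wedge. -/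
noncomputable def Aminus (θ : ℝ) : Matrix (Fin 3) (Fin 3) ℝ :=
  rotMat (-((Real.pi - θ) / 2)) * noslipT * rotMat ((Real.pi - θ) / 2)

/-- Two-collision velocity map of the angle-`θ` no-slip wedge. -/
noncomputable def wedgeS (θ : ℝ) : Matrix (Fin 3) (Fin 3) ℝ :=
  Aminus θ * Aplus θ

/-- The half-turn about the spatial rotation by `φ` of the axis `(1, √2, 0)` of `noslipT`. -/
theorem rotMat_mul_noslipT_mul_rotMat_neg (φ : ℝ) :
    rotMat φ * noslipT * rotMat (-φ) =
      !![-1/3, 2 * √2 / 3 * cos φ, 2 * √2 / 3 * sin φ;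
         2 * √2 / 3 * cos φ, 4 / 3 * cos φ ^ 2 - 1, 4 / 3 * cos φ * sin φ;
         2 * √2 / 3 * sin φ, 4 / 3 * cos φ * sin φ, 4 / 3 * sin φ ^ 2 - 1] := by
  have h := sin_sq_add_cos_sq φ
  ext i j
  fin_cases i <;> fin_cases j <;>
    simp [rotMat, noslipT, Matrix.mul_apply, Fin.sum_univ_three] <;> grind

theorem rotMat_neg_mul_rotMat (φ : ℝ) : rotMat (-φ) * rotMat φ = 1 := by
  have h := sin_sq_add_cos_sq φ
  ext i j
  fin_cases i <;> fin_cases j <;>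
    simp [rotMat, Matrix.mul_apply, Fin.sum_univ_three] <;> grind

theorem rotMat_mul_rotMat_neg (φ : ℝ) : rotMat φ * rotMat (-φ) = 1 := by
  simpa using rotMat_neg_mul_rotMat (-φ)

theorem noslipT_mul_self : noslipT * noslipT = 1 := by
  have h : √2 ^ 2 = 2 := sq_sqrt (by norm_num)
  ext i j
  fin_cases i <;> fin_cases j <;>
    simp [noslipT, Matrix.mul_apply, Fin.sum_univ_three] <;> grind

theorem Aminus_mul_self (θ : ℝ) : Aminus θ * Aminus θ = 1 := by
  have h := rotMat_mul_rotMat_neg ((π - θ) / 2)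
  calc Aminus θ * Aminus θ
      = rotMat (-((π - θ) / 2)) * noslipT *
          (rotMat ((π - θ) / 2) * rotMat (-((π - θ) / 2))) *
          noslipT * rotMat ((π - θ) / 2) := by
        simp only [Aminus, Matrix.mul_assoc]
    _ = rotMat (-((π - θ) / 2)) * (noslipT * noslipT) * rotMat ((π - θ) / 2) := by
        rw [h, Matrix.mul_one, Matrix.mul_assoc (rotMat _) noslipT noslipT]
    _ = 1 := by rw [noslipT_mul_self, Matrix.mul_one, rotMat_neg_mul_rotMat]

theorem wedgeS_mulVec_eq_self_iff (θ : ℝ) (v : Fin 3 → ℝ) :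
    wedgeS θ *ᵥ v = v ↔ Aplus θ *ᵥ v = Aminus θ *ᵥ v := by
  rw [wedgeS, ← mulVec_mulVec]
  constructor <;> intro h
  · simpa [mulVec_mulVec, ← Matrix.mul_assoc, Aminus_mul_self] using
      congrArg (Aminus θ *ᵥ ·) h
  · rw [h, mulVec_mulVec, Aminus_mul_self, one_mulVec]

/-- The fixed vectors of the two-collision velocity map of the angle-`θ`
no-slip wedge are exactly the multiples of the axis of periodicity
`(−√2 sin(θ/2), 1, 0)`. -/
theorem wedge_fixed_vectors (θ : ℝ) (hθ : θ ∈ Set.Ioo 0 Real.pi)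
    (v : Fin 3 → ℝ) :
    (wedgeS θ).mulVec v = v ↔
      v 2 = 0 ∧ v 0 = -Real.sqrt 2 * Real.sin (θ / 2) * v 1 := by
  have hs : sin ((π - θ) / 2) ≠ 0 :=
    (sin_pos_of_pos_of_lt_pi (by linarith [hθ.2]) (by linarith [hθ.1, pi_pos])).ne'
  have hc : cos ((π - θ) / 2) = sin (θ / 2) := by
    rw [← cos_pi_div_two_sub]; ring_nf
  have h2 : √2 ^ 2 = 2 := sq_sqrt (by norm_num)
  have hp : Aplus θ = _ := rotMat_mul_noslipT_mul_rotMat_neg ((π - θ) / 2)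
  have hm := rotMat_mul_noslipT_mul_rotMat_neg (-((π - θ) / 2))
  simp only [neg_neg, cos_neg, sin_neg] at hm
  change Aminus θ = _ at hm
  rw [wedgeS_mulVec_eq_self_iff, hp, hm, hc, funext_iff]
  simp only [Fin.forall_fin_succ, mulVec, dotProduct, Fin.sum_univ_three]
  simp
  constructor <;> grind
end

section
/- Let θ ∈ (0, π) and let v := (−√2·sin(θ/2), 1, 0) ∈ ℝ³. Then A₊(θ)·v = −v and A₋(θ)·v = −v; that is, along the axis of periodicity the no-slip collision at either wall of the angle-θ wedge exactly reverses the velocity, producing a period-two orbit. -/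
open Real Matrix

/-- The collision matrix reverses every vector of the plane `x₀ = -√2 x₁`. -/
theorem noslipT_mulVec_eq_neg (a b : ℝ) :
    noslipT.mulVec ![-Real.sqrt 2 * a, a, b] = -![-Real.sqrt 2 * a, a, b] := by
  have h : Real.sqrt 2 * Real.sqrt 2 = 2 := Real.mul_self_sqrt (by norm_num)
  ext i
  fin_cases i
  · simp [noslipT, mulVec, dotProduct, Fin.sum_univ_three]
    ring
  · simp [noslipT, mulVec, dotProduct, Fin.sum_univ_three]
    linear_combination (-2 * a / 3) * h
  · simp [noslipT, mulVec, dotProduct, Fin.sum_univ_three]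

theorem rotMat_mulVec (φ x y z : ℝ) :
    (rotMat φ).mulVec ![x, y, z] =
      ![x, Real.cos φ * y - Real.sin φ * z, Real.sin φ * y + Real.cos φ * z] := by
  ext i
  fin_cases i <;> simp [rotMat, mulVec, dotProduct, Fin.sum_univ_three, sub_eq_add_neg]

/-- The collision at a wall rotated by `φ` reverses the vector `(-√2 cos φ, 1, 0)`. -/
theorem rotMat_conj_noslipT_mulVec (φ : ℝ) :
    (rotMat φ * noslipT * rotMat (-φ)).mulVec ![-Real.sqrt 2 * Real.cos φ, 1, 0] =
      -![-Real.sqrt 2 * Real.cos φ, 1, 0] := by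
  rw [← mulVec_mulVec, ← mulVec_mulVec, rotMat_mulVec]
  simp only [Real.cos_neg, Real.sin_neg, mul_one, mul_zero, sub_zero, add_zero]
  rw [noslipT_mulVec_eq_neg, mulVec_neg, rotMat_mulVec]
  congr 1
  ext i
  fin_cases i
  · simp
  · simp
    linear_combination Real.sin_sq_add_cos_sq φ
  · simp
    ring

/-- Along the axis of periodicity, the no-slip collision at either wall of the
angle-`θ` wedge exactly reverses the velocity. -/
theorem wedge_axis_of_periodicity (θ : ℝ) (hθ : θ ∈ Set.Ioo 0 Real.pi)
    (v : Fin 3 → ℝ) (hv : v = ![-Real.sqrt 2 * Real.sin (θ / 2), 1, 0]) :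
    (Aplus θ).mulVec v = -v ∧ (Aminus θ).mulVec v = -v := by
  subst hv
  have h : Real.sin (θ / 2) = Real.cos ((Real.pi - θ) / 2) := by
    rw [← Real.cos_pi_div_two_sub]
    congr 1
    ring
  rw [h]
  refine ⟨rotMat_conj_noslipT_mulVec _, ?_⟩
  have key := rotMat_conj_noslipT_mulVec (-((Real.pi - θ) / 2))
  rwa [neg_neg, Real.cos_neg] at key
end

section
/- For every θ ∈ ℝ, the dot product of (0,0,1) with S_θ·(0,0,1) equals (32/9)·cos⁴(θ/2) − (16/3)·cos²(θ/2) + 1. Since (0,0,1) is a unit vector orthogonal to the rotation axis of S_θ, this expresses the relation cos α = (32/9)cos⁴(θ/2) − (16/3)cos²(θ/2) + 1 between the wedge angle θ and the rotation angle α of the two-collision velocity map S_θ. -/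
open Real Matrix

/-- Relation between the wedge angle `θ` and the rotation angle `α` of the
two-collision velocity map `S_θ`:
`cos α = (32/9)cos⁴(θ/2) − (16/3)cos²(θ/2) + 1`, expressed via the unit
vector `(0,0,1)` orthogonal to the rotation axis. -/
theorem wedge_rotation_angle (θ : ℝ) :
    dotProduct (![0, 0, 1] : Fin 3 → ℝ) ((wedgeS θ).mulVec ![0, 0, 1]) =
      (32 / 9) * Real.cos (θ / 2) ^ 4 - (16 / 3) * Real.cos (θ / 2) ^ 2 + 1 := by
  have hψ : (Real.pi - θ) / 2 = Real.pi / 2 - θ / 2 := by ring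
  have h2 : Real.sqrt 2 ^ 2 = 2 := Real.sq_sqrt (by norm_num)
  have hs : Real.sin (θ / 2) ^ 2 = 1 - Real.cos (θ / 2) ^ 2 := Real.sin_sq (θ / 2)
  simp only [wedgeS, Aplus, Aminus, rotMat, noslipT, hψ, Real.cos_neg, Real.sin_neg,
    Real.cos_pi_div_two_sub, Real.sin_pi_div_two_sub]
  generalize Real.sin (θ / 2) = s at *
  generalize Real.cos (θ / 2) = c at *
  simp [Matrix.mul_apply, Matrix.mulVec, dotProduct, Fin.sum_univ_three]
  grind
end

section
/- For every integer n ≥ 2 there exists θ ∈ (0, π) such that the matrix S_θ has order exactly 2n: S_θ^(2n) = 1, and S_θ^k ≠ 1 for every integer k with 1 ≤ k < 2n. Consequently, for each n ≥ 2 there is a wedge angle θ for which every bounded nondegenerate orbit of the angle-θ no-slip wedge billiard is periodic of period 2n. -/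
open Real Matrix

/-- The matrix of the cross product with `(p, q, 0)`. -/
def planarCross (p q : ℝ) : Matrix (Fin 3) (Fin 3) ℝ :=
  !![0, 0, q; 0, 0, -p; -q, p, 0]

theorem planarCross_pow_three (p q : ℝ) :
    planarCross p q ^ 3 = -(p ^ 2 + q ^ 2) • planarCross p q := by
  ext i j
  fin_cases i <;> fin_cases j <;>
    simp [planarCross, pow_succ, Matrix.mul_apply, Fin.sum_univ_three] <;> ring

theorem trace_planarCross (p q : ℝ) : (planarCross p q).trace = 0 := by
  simp [planarCross, Matrix.trace, Fin.sum_univ_three]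

theorem trace_planarCross_sq (p q : ℝ) :
    (planarCross p q ^ 2).trace = -2 * (p ^ 2 + q ^ 2) := by
  simp [planarCross, Matrix.trace, Fin.sum_univ_three, pow_two]
  ring

/-- Powers of a rotation given by Rodrigues' formula. -/
theorem rodrigues_pow {A : Type*} [Ring A] [Algebra ℝ A] {K : A} (hK : K ^ 3 = -K)
    (α : ℝ) (k : ℕ) :
    (1 + Real.sin α • K + (1 - Real.cos α) • K ^ 2) ^ k =
      1 + Real.sin (k * α) • K + (1 - Real.cos (k * α)) • K ^ 2 := by
  induction k with
  | zero => simp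
  | succ k ih =>
    have hK4 : K ^ 4 = -K ^ 2 := by
      rw [pow_succ, hK, neg_mul, sq]
    have h12 : K * K ^ 2 = -K := by rw [← pow_succ', hK]
    have h21 : K ^ 2 * K = -K := by rw [← pow_succ, hK]
    have h22 : K ^ 2 * K ^ 2 = -K ^ 2 := by rw [← pow_add, hK4]
    rw [pow_succ, ih, Nat.cast_succ, add_mul (k : ℝ) 1 α, one_mul, Real.sin_add, Real.cos_add]
    simp only [add_mul, mul_add, smul_mul_smul_comm, one_mul, mul_one, h12, h21, h22, ← sq]
    module

theorem wedgeS_eq (θ : ℝ) :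
    wedgeS θ =
      1 + (2 * (1 - 4 / 3 * Real.sin ((Real.pi - θ) / 2) ^ 2)) •
          planarCross (-(4 / 3) * Real.cos ((Real.pi - θ) / 2) * Real.sin ((Real.pi - θ) / 2))
            (2 * Real.sqrt 2 / 3 * Real.sin ((Real.pi - θ) / 2)) +
        (2 : ℝ) •
          planarCross (-(4 / 3) * Real.cos ((Real.pi - θ) / 2) * Real.sin ((Real.pi - θ) / 2))
            (2 * Real.sqrt 2 / 3 * Real.sin ((Real.pi - θ) / 2)) ^ 2 := by
  unfold wedgeS Aminus Aplus
  generalize (Real.pi - θ) / 2 = ψ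
  have hr : Real.sqrt 2 ^ 2 = 2 := Real.sq_sqrt (by norm_num)
  have hc : Real.cos ψ ^ 2 = 1 - Real.sin ψ ^ 2 := Real.cos_sq' ψ
  ext i j
  fin_cases i <;> fin_cases j <;>
    simp [planarCross, noslipT, rotMat, pow_two, Matrix.mul_apply, Fin.sum_univ_three] <;>
    grind

/-- If `cos γ = (1 - 2 cos θ) / 3`, then `S_θ` is a rotation by the angle `2γ`. -/
theorem exists_wedgeS_eq_rodrigues {θ γ : ℝ} (hγ : Real.sin γ ≠ 0)
    (h : Real.cos γ = (1 - 2 * Real.cos θ) / 3) :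
    ∃ K : Matrix (Fin 3) (Fin 3) ℝ, K ^ 3 = -K ∧ K.trace = 0 ∧ (K ^ 2).trace = -2 ∧
      wedgeS θ = 1 + Real.sin (2 * γ) • K + (1 - Real.cos (2 * γ)) • K ^ 2 := by
  have hs : Real.sin ((Real.pi - θ) / 2) ^ 2 = (1 + Real.cos θ) / 2 := by
    rw [Real.sin_sq_eq_half_sub, mul_div_cancel₀ _ two_ne_zero, Real.cos_pi_sub]
    ring
  have hcos : 1 - 4 / 3 * Real.sin ((Real.pi - θ) / 2) ^ 2 = Real.cos γ := by
    rw [hs, h]; ring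
  have hS := wedgeS_eq θ
  rw [hcos] at hS
  set p := -(4 / 3) * Real.cos ((Real.pi - θ) / 2) * Real.sin ((Real.pi - θ) / 2) with hp
  set q := 2 * Real.sqrt 2 / 3 * Real.sin ((Real.pi - θ) / 2) with hq
  have hpq : p ^ 2 + q ^ 2 = Real.sin γ ^ 2 := by
    rw [hp, hq, mul_pow, mul_pow, mul_pow, div_pow, mul_pow, Real.sq_sqrt zero_le_two,
      Real.cos_sq', Real.sin_sq γ, h, hs]
    ring
  refine ⟨(Real.sin γ)⁻¹ • planarCross p q, ?_, ?_, ?_, ?_⟩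
  · rw [smul_pow, planarCross_pow_three, hpq, smul_smul, ← neg_smul]
    congr 1
    field_simp
  · rw [Matrix.trace_smul, trace_planarCross, smul_zero]
  · rw [smul_pow, Matrix.trace_smul, trace_planarCross_sq, hpq, smul_eq_mul]
    field_simp
  · rw [hS, smul_pow, smul_smul, smul_smul, Real.sin_two_mul, Real.cos_two_mul, Real.cos_sq']
    congr 3 <;> field_simp
    ring

/-- For every `n ≥ 2` there is a wedge angle `θ ∈ (0, π)` for which the
two-collision velocity map `S_θ` has order exactly `2n`; hence every bounded
nondegenerate orbit of the angle-`θ` no-slip wedge has period `2n`. -/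
theorem wedge_exists_angle_of_order (n : ℕ) (hn : 2 ≤ n) :
    ∃ θ ∈ Set.Ioo 0 Real.pi,
      wedgeS θ ^ (2 * n) = 1 ∧
        ∀ k : ℕ, 1 ≤ k → k < 2 * n → wedgeS θ ^ k ≠ 1 := by
  have hn0 : (0 : ℝ) < n := by positivity
  have hn2 : (2 : ℝ) ≤ n := by exact_mod_cast hn
  have hγ0 : 0 < Real.pi / (2 * n) := by positivity
  have hγ1 : Real.pi / (2 * n) < Real.pi / 2 := by
    gcongr
    linarith
  have hc0 : 0 < Real.cos (Real.pi / (2 * n)) := Real.cos_pos_of_mem_Ioo ⟨by linarith, hγ1⟩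
  have hs0 : 0 < Real.sin (Real.pi / (2 * n)) := Real.sin_pos_of_pos_of_lt_pi hγ0 (by linarith)
  have hc1 : Real.cos (Real.pi / (2 * n)) < 1 := by
    nlinarith [Real.sin_sq_add_cos_sq (Real.pi / (2 * n))]
  obtain ⟨θ, ⟨hθ0, hθπ⟩, hθ⟩ : ∃ θ ∈ Set.Ioo 0 Real.pi,
      Real.cos θ = (1 - 3 * Real.cos (Real.pi / (2 * n))) / 2 :=
    ⟨Real.arccos ((1 - 3 * Real.cos (Real.pi / (2 * n))) / 2),
      ⟨Real.arccos_pos.2 (by linarith), Real.arccos_lt_pi.2 (by linarith)⟩,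
      Real.cos_arccos (by linarith) (by linarith)⟩
  obtain ⟨K, hK, htr, htr2, hS⟩ :=
    exists_wedgeS_eq_rodrigues (θ := θ) hs0.ne' (by rw [hθ]; ring)
  have hα : 2 * (Real.pi / (2 * n)) = Real.pi / n := by field_simp
  rw [hα] at hS
  refine ⟨θ, ⟨hθ0, hθπ⟩, ?_, fun k hk hkn hone => ?_⟩
  · have h2π : ((2 * n : ℕ) : ℝ) * (Real.pi / n) = 2 * Real.pi := by
      push_cast
      field_simp
    rw [hS, rodrigues_pow hK, h2π]
    simp
  · rw [hS, rodrigues_pow hK] at hone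
    have htrace := congrArg Matrix.trace hone
    simp only [Matrix.trace_add, Matrix.trace_smul, htr, htr2, smul_eq_mul] at htrace
    have hcos : Real.cos (k * (Real.pi / n)) = 1 := by linarith
    have hk0 : (0 : ℝ) < k := by exact_mod_cast hk
    have hpos : 0 < k * (Real.pi / n) := by positivity
    have hlt : k * (Real.pi / n) < 2 * Real.pi := by
      have hkn' : (k : ℝ) < 2 * n := by exact_mod_cast hkn
      calc k * (Real.pi / n) < 2 * n * (Real.pi / n) := by gcongr
        _ = 2 * Real.pi := by field_simp
    exact hpos.ne' ((Real.cos_eq_one_iff_of_lt_of_lt (by linarith) hlt).1 hcos)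
end

section
/- For the wedge of angle θ = π/3, the two-collision velocity map satisfies S_{π/3}² = 1 and S_{π/3} ≠ 1. Hence every bounded nondegenerate orbit of the no-slip wedge billiard of angle π/3 has period four. -/
open Real Matrix

theorem wedgeS_pi_div_three :
    wedgeS (Real.pi / 3) =
      !![-1/3, -(2 * Real.sqrt 2 / 3), 0;
         -(2 * Real.sqrt 2 / 3), 1/3, 0;
         0, 0, -1] := by
  have hψ : (Real.pi - Real.pi / 3) / 2 = Real.pi / 3 := by ring
  have h2 : Real.sqrt 2 ^ 2 = 2 := Real.sq_sqrt (by norm_num)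
  have h3 : Real.sqrt 3 ^ 2 = 3 := Real.sq_sqrt (by norm_num)
  rw [wedgeS, Aminus, Aplus, hψ]
  ext i j
  fin_cases i <;> fin_cases j <;>
    simp [rotMat, noslipT, Matrix.mul_apply, Fin.sum_univ_three] <;>
    grind

/-- For the wedge of angle `π/3`, the two-collision velocity map satisfies
`S² = 1` and `S ≠ 1`; hence every bounded nondegenerate orbit has period four. -/
theorem wedge_pi_div_three_order_two :
    wedgeS (Real.pi / 3) ^ 2 = 1 ∧ wedgeS (Real.pi / 3) ≠ 1 := by
  refine ⟨?_, fun h => ?_⟩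
  · have h2 : Real.sqrt 2 ^ 2 = 2 := Real.sq_sqrt (by norm_num)
    rw [wedgeS_pi_div_three, sq]
    ext i j
    fin_cases i <;> fin_cases j <;>
      simp [Matrix.mul_apply, Fin.sum_univ_three] <;>
      grind
  · have h00 := congrFun (congrFun h 0) 0
    norm_num [wedgeS_pi_div_three] at h00
end

section
/- Let θ ∈ (0, π) and let n ≥ 1 be an integer. If (32/9)·cos⁴(θ/2) − (16/3)·cos²(θ/2) + 1 = cos(π/n), then S_θ^(2n) = 1; that is, if the rotation angle of the two-collision velocity map of the angle-θ wedge is π/n, then all velocities are periodic with period dividing 2n collisions. -/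
open Real Matrix

/-- The Cayley–Hamilton relation for a `3 × 3` rotation matrix. -/
theorem Matrix.sub_one_mul_eq_zero_of_rotation {M : Matrix (Fin 3) (Fin 3) ℝ}
    (hM : Mᵀ * M = 1) (hdet : M.det = 1) :
    (M - 1) * (M * M - (M.trace - 1) • M + 1) = 0 := by
  have cayley_hamilton : M * M * M - M.trace • (M * M) + M.adjugate.trace • M
      - M.det • (1 : Matrix (Fin 3) (Fin 3) ℝ) = 0 := by
    clear hM hdet
    rw [adjugate_fin_three, det_fin_three, trace_fin_three, trace_fin_three]
    ext i j
    fin_cases i <;> fin_cases j <;>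
      simp [Matrix.mul_apply, Fin.sum_univ_three] <;> ring
  have hadj : M.adjugate = Mᵀ := by
    have h1 : Mᵀ * (M * M.adjugate) = Mᵀ := by rw [mul_adjugate, hdet]; simp
    rwa [← mul_assoc, hM, one_mul] at h1
  rw [hadj, hdet, trace_transpose] at cayley_hamilton
  rw [← cayley_hamilton]
  simp only [sub_mul, mul_add, mul_sub, mul_smul_comm, one_mul, mul_one, ← mul_assoc]
  module

/-- A `3 × 3` rotation matrix of trace `-1` is a half turn. -/
theorem Matrix.mul_self_eq_one_of_rotation {M : Matrix (Fin 3) (Fin 3) ℝ}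
    (hM : Mᵀ * M = 1) (hdet : M.det = 1) (htr : M.trace = -1) : M * M = 1 := by
  have hch := sub_one_mul_eq_zero_of_rotation hM hdet
  rw [htr] at hch
  have hsq : (M * M - 1) * (M * M - 1) = 0 := by
    calc (M * M - 1) * (M * M - 1) = ((M - 1) * (M * M - (-1 - 1 : ℝ) • M + 1)) * (M - 1) := by
          rw [show (-1 - 1 : ℝ) = -2 by norm_num, neg_smul, two_smul]
          noncomm_ring
      _ = 0 := by rw [hch, zero_mul]
  have htwo : Mᵀ * Mᵀ * (M * M) = 1 := by
    rw [mul_assoc, ← mul_assoc Mᵀ M M, hM, one_mul, hM]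
  have hzero : (M * M - 1)ᴴ * (M * M - 1) = 0 := by
    have hT : (M * M - 1)ᴴ = -(Mᵀ * Mᵀ * (M * M - 1)) := by
      rw [mul_sub, htwo]
      simp [conjTranspose_eq_transpose_of_trivial, transpose_mul]
    rw [hT, neg_mul, mul_assoc, hsq, mul_zero, neg_zero]
  exact sub_eq_zero.mp (conjTranspose_mul_self_eq_zero.mp hzero)

/-- Powers of an operator annihilated on `Q` by `X² - 2 cos α X + 1`. -/
theorem sin_smul_pow_mul {A : Type*} [Ring A] [Algebra ℝ A] {M Q : A} {α : ℝ}
    (h : M * (M * Q) = (2 * cos α) • (M * Q) - Q) (k : ℕ) :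
    sin α • (M ^ k * Q) = sin (k * α) • (M * Q) - sin (k * α - α) • Q := by
  induction k with
  | zero => simp
  | succ k ih =>
    rw [pow_succ', mul_assoc, ← mul_smul_comm, ih, mul_sub, mul_smul_comm, mul_smul_comm, h]
    have h1 : sin ((k + 1 : ℕ) * α) = 2 * cos α * sin (k * α) - sin (k * α - α) := by
      push_cast
      rw [add_mul, one_mul, sin_add, sin_sub]
      ring
    have h2 : ((k + 1 : ℕ) : ℝ) * α - α = k * α := by push_cast; ring
    rw [h1, h2]
    module

/-- A rotation by an angle `α` with `sin α ≠ 0` and `k α ∈ 2πℤ` has `k`-th power the identity. -/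
theorem pow_eq_one_of_sub_one_mul_eq_zero {A : Type*} [Ring A] [Algebra ℝ A] {M : A} {α : ℝ}
    (h : (M - 1) * (M * M - (2 * cos α) • M + 1) = 0) (hα : sin α ≠ 0) {k : ℕ}
    (hsin : sin (k * α) = 0) (hcos : cos (k * α) = 1) : M ^ k = 1 := by
  set W := M * M - (2 * cos α) • M + 1 with hW
  set Q := (2 - 2 * cos α) • (1 : A) - W with hQ
  have hMW : M * W = W := by rwa [sub_mul, one_mul, sub_eq_zero] at h
  have hMQ : M * (M * Q) = (2 * cos α) • (M * Q) - Q := by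
    have e1 : M * Q = (2 - 2 * cos α) • M - W := by
      rw [hQ, mul_sub, hMW, mul_smul_comm, mul_one]
    have e2 : M * (M * Q) = (2 - 2 * cos α) • (M * M) - W := by
      rw [e1, mul_sub, hMW, mul_smul_comm]
    have e3 : M * M = W + (2 * cos α) • M - 1 := by rw [hW]; abel
    rw [e2, e1, hQ, e3]
    module
  have hpowW : M ^ k * W = W := by
    clear hsin hcos
    induction k with
    | zero => simp
    | succ k ih => rw [pow_succ, mul_assoc, hMW, ih]
  have hpowQ : M ^ k * Q = Q := by
    have h1 := sin_smul_pow_mul hMQ k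
    rw [sin_sub, hsin, hcos] at h1
    refine smul_right_injective A hα ?_
    simpa using h1
  have hne : 2 - 2 * cos α ≠ 0 := by
    intro h0
    have : cos α = 1 := by linarith
    exact hα (sin_eq_zero_iff_cos_eq.mpr (Or.inl this))
  refine smul_right_injective A hne ?_
  have h1 : (2 - 2 * cos α) • (1 : A) = Q + W := by rw [hQ]; abel
  calc (2 - 2 * cos α) • M ^ k = M ^ k * ((2 - 2 * cos α) • (1 : A)) := by simp
    _ = (2 - 2 * cos α) • (1 : A) := by rw [h1, mul_add, hpowQ, hpowW]

theorem noslipT_mem_specialOrthogonalGroup :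
    noslipT ∈ specialOrthogonalGroup (Fin 3) ℝ := by
  have h2 : √2 * √2 = (2 : ℝ) := mul_self_sqrt (by norm_num)
  rw [mem_specialOrthogonalGroup_iff, mem_orthogonalGroup_iff]
  constructor
  · ext i j
    fin_cases i <;> fin_cases j <;>
      simp [noslipT, Matrix.mul_apply, Fin.sum_univ_three] <;> linarith
  · simp [noslipT, det_fin_three]
    linarith

theorem rotMat_mem_specialOrthogonalGroup (φ : ℝ) :
    rotMat φ ∈ specialOrthogonalGroup (Fin 3) ℝ := by
  have h := sin_sq_add_cos_sq φ
  rw [mem_specialOrthogonalGroup_iff, mem_orthogonalGroup_iff]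
  constructor
  · ext i j
    fin_cases i <;> fin_cases j <;>
      simp [rotMat, Matrix.mul_apply, Fin.sum_univ_three] <;> linarith
  · simp [rotMat, det_fin_three]
    linarith

theorem wedgeS_mem_specialOrthogonalGroup (θ : ℝ) :
    wedgeS θ ∈ specialOrthogonalGroup (Fin 3) ℝ := by
  have hT := noslipT_mem_specialOrthogonalGroup
  have hR := rotMat_mem_specialOrthogonalGroup
  exact mul_mem (mul_mem (mul_mem (hR _) hT) (hR _)) (mul_mem (mul_mem (hR _) hT) (hR _))

theorem trace_wedgeS (θ : ℝ) :
    (wedgeS θ).trace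
      = 2 * ((32 / 9) * cos (θ / 2) ^ 4 - (16 / 3) * cos (θ / 2) ^ 2 + 1) + 1 := by
  have h2 : √2 ^ 2 = (2 : ℝ) := sq_sqrt (by norm_num)
  have hc : cos ((π - θ) / 2) = sin (θ / 2) := by rw [sub_div, cos_pi_div_two_sub]
  have hs : sin ((π - θ) / 2) = cos (θ / 2) := by rw [sub_div, sin_pi_div_two_sub]
  have hsq : sin (θ / 2) ^ 2 = 1 - cos (θ / 2) ^ 2 := sin_sq _
  have hsq4 : sin (θ / 2) ^ 4 = (1 - cos (θ / 2) ^ 2) ^ 2 := by rw [← hsq]; ring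
  simp only [wedgeS, Aplus, Aminus, rotMat, noslipT, cos_neg, sin_neg, hc, hs, trace_fin_three,
    Matrix.mul_apply, Fin.sum_univ_three]
  generalize sin (θ / 2) = s at *
  generalize cos (θ / 2) = c at *
  simp
  ring_nf
  simp only [h2, hsq, hsq4]
  ring

/-- If the rotation angle of the two-collision velocity map of the angle-`θ`
wedge is `π/n`, then all velocities are periodic with period dividing `2n`
collisions. -/
theorem wedge_rotation_angle_pi_div_n_periodic (θ : ℝ)
    (hθ : θ ∈ Set.Ioo 0 Real.pi) (n : ℕ) (hn : 1 ≤ n)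
    (h : (32 / 9) * Real.cos (θ / 2) ^ 4 - (16 / 3) * Real.cos (θ / 2) ^ 2 + 1
          = Real.cos (Real.pi / n)) :
    wedgeS θ ^ (2 * n) = 1 := by
  have hmem := mem_specialOrthogonalGroup_iff.mp (wedgeS_mem_specialOrthogonalGroup θ)
  have hdet := hmem.2
  have horth : (wedgeS θ)ᵀ * wedgeS θ = 1 := by
    rw [← conjTranspose_eq_transpose_of_trivial]
    exact (mem_orthogonalGroup_iff' _ _).mp hmem.1
  have htr : (wedgeS θ).trace = 2 * cos (π / n) + 1 := by rw [trace_wedgeS, h]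
  obtain rfl | hn2 : n = 1 ∨ 2 ≤ n := by omega
  · rw [mul_one, pow_two]
    refine mul_self_eq_one_of_rotation horth hdet ?_
    rw [htr]
    norm_num
  · have hn2' : (2 : ℝ) ≤ n := by exact_mod_cast hn2
    have hangle : ((2 * n : ℕ) : ℝ) * (π / n) = 2 * π := by
      push_cast
      field_simp
    have hch := sub_one_mul_eq_zero_of_rotation horth hdet
    rw [htr, add_sub_cancel_right] at hch
    refine pow_eq_one_of_sub_one_mul_eq_zero hch ?_ ?_ ?_
    · refine (sin_pos_of_pos_of_lt_pi (by positivity) ?_).ne'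
      exact div_lt_self pi_pos (by linarith)
    · rw [hangle, sin_two_pi]
    · rw [hangle, cos_two_pi]
end

section
/- The image of the interval (0, π) under the function f(θ) := (32/9)·cos⁴(θ/2) − (16/3)·cos²(θ/2) + 1 is exactly the half-open interval [−1, 1). In particular, f attains the value −1 (at θ = π/3) and, for every integer n ≥ 2, f attains the value cos(π/n) for some θ ∈ (0, π). -/
open Real

/-- The cosine of the rotation angle of the two-collision velocity map `S_θ`
of the no-slip wedge billiard of angle `θ`, as a function of `θ`. -/
noncomputable def wedgeCos (θ : ℝ) : ℝ :=
  (32 / 9) * Real.cos (θ / 2) ^ 4 - (16 / 3) * Real.cos (θ / 2) ^ 2 + 1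

theorem wedgeCos_eq (θ : ℝ) : wedgeCos θ = 2 / 9 * (2 * cos θ - 1) ^ 2 - 1 := by
  have h : cos (θ / 2) ^ 2 = 1 / 2 + cos θ / 2 := by
    rw [cos_sq, mul_div_cancel₀ θ two_ne_zero]
  have h4 : cos (θ / 2) ^ 4 = (cos (θ / 2) ^ 2) ^ 2 := by ring
  rw [wedgeCos, h4, h]
  ring

theorem wedgeCos_image_Ioo : wedgeCos '' Set.Ioo 0 π = Set.Ico (-1 : ℝ) 1 := by
  ext y
  constructor
  · rintro ⟨θ, ⟨h0, hpi⟩, rfl⟩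
    have hlt : cos θ < 1 := by
      simpa using cos_lt_cos_of_nonneg_of_le_pi le_rfl hpi.le h0
    have hgt : -1 < cos θ := by
      simpa using cos_lt_cos_of_nonneg_of_le_pi h0.le le_rfl hpi
    rw [wedgeCos_eq]
    constructor <;> nlinarith [sq_nonneg (2 * cos θ - 1)]
  · rintro ⟨hy, hy'⟩
    have hs0 : 0 ≤ √(9 * (y + 1) / 2) := sqrt_nonneg _
    have hs3 : √(9 * (y + 1) / 2) < 3 := by
      rw [sqrt_lt' (by norm_num)]
      linarith
    have hsq : √(9 * (y + 1) / 2) ^ 2 = 9 * (y + 1) / 2 := sq_sqrt (by linarith)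
    set s := √(9 * (y + 1) / 2)
    have hlt : (1 - s) / 2 < 1 := by linarith
    have hgt : -1 < (1 - s) / 2 := by linarith
    refine ⟨arccos ((1 - s) / 2), ⟨arccos_pos.2 hlt, ?_⟩, ?_⟩
    · exact lt_of_le_of_ne (arccos_le_pi _) fun h => hgt.not_ge (arccos_eq_pi.1 h)
    · rw [wedgeCos_eq, cos_arccos hgt.le hlt.le]
      linear_combination 2 / 9 * hsq

/-- The image of `(0, π)` under `f(θ) = (32/9)cos⁴(θ/2) − (16/3)cos²(θ/2) + 1`
is exactly `[−1, 1)`. In particular `f(π/3) = −1` and for every `n ≥ 2` the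
value `cos(π/n)` is attained. -/
theorem wedgeCos_image :
    wedgeCos '' Set.Ioo 0 Real.pi = Set.Ico (-1 : ℝ) 1 ∧
      wedgeCos (Real.pi / 3) = -1 ∧
        ∀ n : ℕ, 2 ≤ n → ∃ θ ∈ Set.Ioo 0 Real.pi,
          wedgeCos θ = Real.cos (Real.pi / n) := by
  refine ⟨wedgeCos_image_Ioo, ?_, fun n hn => ?_⟩
  · rw [wedgeCos_eq, cos_pi_div_three]
    norm_num
  · have hn' : (1 : ℝ) < n := by exact_mod_cast hn
    have hpos : 0 < π / n := by positivity
    have hle : π / n ≤ π := div_le_self pi_pos.le hn'.le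
    have hlt : cos (π / n) < 1 := by
      simpa using cos_lt_cos_of_nonneg_of_le_pi le_rfl hle hpos
    have hmem : cos (π / n) ∈ wedgeCos '' Set.Ioo 0 π :=
      wedgeCos_image_Ioo ▸ ⟨neg_one_le_cos _, hlt⟩
    exact hmem
end

section
/- Let S₁ := T·R(2π/3) and S₂ := T·R(−2π/3). Then S₁³ = 1 and S₂³ = 1; that is, each per-collision velocity map of the no-slip equilateral-triangle billiard is a rotation of order three, which underlies the existence of period-three and period-six orbits. -/
open Real Matrix

/-- Per-collision velocity map `S₁ = T·R(2π/3)` of the no-slip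
equilateral-triangle billiard. -/
noncomputable def triS₁ : Matrix (Fin 3) (Fin 3) ℝ :=
  noslipT * rotMat (2 * Real.pi / 3)

/-- Per-collision velocity map `S₂ = T·R(−2π/3)` of the no-slip
equilateral-triangle billiard. -/
noncomputable def triS₂ : Matrix (Fin 3) (Fin 3) ℝ :=
  noslipT * rotMat (-(2 * Real.pi / 3))

theorem cos_two_pi_div_three : Real.cos (2 * Real.pi / 3) = -1 / 2 := by
  rw [show 2 * Real.pi / 3 = Real.pi - Real.pi / 3 by ring, Real.cos_pi_sub, Real.cos_pi_div_three]
  norm_num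

/-- `T·R(φ)` has order three whenever `cos φ = -1/2`. -/
theorem noslipT_mul_rotMat_pow_three {φ : ℝ} (hc : Real.cos φ = -1 / 2) :
    (noslipT * rotMat φ) ^ 3 = 1 := by
  have hs : Real.sin φ ^ 2 = 3 / 4 := by
    rw [Real.sin_sq, hc]
    norm_num
  have hr : Real.sqrt 2 ^ 2 = 2 := Real.sq_sqrt (by norm_num)
  rw [noslipT, rotMat, hc, pow_three]
  generalize Real.sin φ = s at hs
  generalize Real.sqrt 2 = r at hr
  ext i j
  fin_cases i <;> fin_cases j <;>
    simp [Matrix.mul_apply, Fin.sum_univ_three] <;> grind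

/-- Each per-collision velocity map of the no-slip equilateral-triangle
billiard is a rotation of order three: `S₁³ = 1` and `S₂³ = 1`. -/
theorem equilateral_triangle_collision_maps_order_three :
    triS₁ ^ 3 = 1 ∧ triS₂ ^ 3 = 1 := by
  refine ⟨noslipT_mul_rotMat_pow_three cos_two_pi_div_three, noslipT_mul_rotMat_pow_three ?_⟩
  rw [Real.cos_neg, cos_two_pi_div_three]
end

section
/- Let θ ∈ (0, π) and suppose that arccos((32/9)cos⁴(θ/2) − (16/3)cos²(θ/2) + 1) is not a rational multiple of π. Let a := (−√2·sin(θ/2), 1, 0) be the axis of periodicity. Then for every v ∈ ℝ³, the closure in ℝ³ of the forward orbit {S_θⁿ·v : n ∈ ℕ} equals the set {w ∈ ℝ³ : w·w = v·v and w·a = v·a}, i.e. the circle through v obtained by intersecting the sphere of radius ‖v‖ with the plane through v orthogonal to a. -/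
open Real Matrix

/-- The rotation `S_θ` in Rodrigues form, with axis `(-√2 sin (θ/2), 1, 0)`. -/
theorem wedgeS_eq_s16 (θ : ℝ) :
    wedgeS θ =
      ((32 / 9) * cos (θ / 2) ^ 4 - (16 / 3) * cos (θ / 2) ^ 2 + 1) •
          (1 : Matrix (Fin 3) (Fin 3) ℝ) +
        (16 / 9 * cos (θ / 2) ^ 2) •
          !![2 * sin (θ / 2) ^ 2, -(√2 * sin (θ / 2)), 0; -(√2 * sin (θ / 2)), 1, 0; 0, 0, 0] +
        (4 * √2 * cos (θ / 2) * (3 - 4 * cos (θ / 2) ^ 2) / 9) •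
          !![0, 0, 1; 0, 0, √2 * sin (θ / 2); -1, -(√2 * sin (θ / 2)), 0] := by
  have hψ : (π - θ) / 2 = π / 2 - θ / 2 := by ring
  have hsq : sin (θ / 2) ^ 2 + cos (θ / 2) ^ 2 = 1 := sin_sq_add_cos_sq _
  have h2 : √2 ^ 2 = (2 : ℝ) := sq_sqrt (by norm_num)
  simp only [wedgeS, Aplus, Aminus, rotMat, noslipT, hψ, cos_neg, sin_neg, cos_pi_div_two_sub,
    sin_pi_div_two_sub]
  generalize sin (θ / 2) = s at *
  generalize cos (θ / 2) = c at *
  generalize √2 = r at *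
  ext i j
  fin_cases i <;> fin_cases j <;>
    simp [Matrix.mul_apply, Fin.sum_univ_three] <;> grind

/-- The vector whose component along `(-m, 1, 0)` is given by `h` and whose component in the
orthogonal plane is given by the complex number `z`. -/
noncomputable def axisFrame (m N h : ℝ) (z : ℂ) : Fin 3 → ℝ :=
  ![-m * h - z.re, h - m * z.re, N * z.im]

theorem continuous_axisFrame (m N h : ℝ) : Continuous (axisFrame m N h) := by
  unfold axisFrame
  refine continuous_pi fun i => ?_
  fin_cases i <;> simp <;> fun_prop

theorem exists_axisFrame_eq {m N : ℝ} (hN : N ^ 2 = m ^ 2 + 1) (v : Fin 3 → ℝ) :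
    ∃ h z, v = axisFrame m N h z := by
  have hN0 : N ≠ 0 := by rintro rfl; nlinarith
  have hm : m ^ 2 + 1 ≠ 0 := by positivity
  refine ⟨(v 1 - m * v 0) / (m ^ 2 + 1), ⟨-(v 0 + m * v 1) / (m ^ 2 + 1), v 2 / N⟩, ?_⟩
  ext i
  fin_cases i <;> simp [axisFrame] <;> field_simp <;> ring

theorem axisFrame_dotProduct_self {m N : ℝ} (hN : N ^ 2 = m ^ 2 + 1) (h : ℝ) (z : ℂ) :
    axisFrame m N h z ⬝ᵥ axisFrame m N h z = N ^ 2 * (h ^ 2 + ‖z‖ ^ 2) := by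
  rw [← Complex.normSq_eq_norm_sq, Complex.normSq_apply]
  simp [axisFrame, dotProduct, Fin.sum_univ_three]
  linear_combination (-h ^ 2 - z.re ^ 2) * hN

theorem axisFrame_dotProduct_axis {m N : ℝ} (hN : N ^ 2 = m ^ 2 + 1) (h : ℝ) (z : ℂ) :
    axisFrame m N h z ⬝ᵥ ![-m, 1, 0] = N ^ 2 * h := by
  simp [axisFrame, dotProduct, Fin.sum_univ_three]
  linear_combination (-h) * hN

/-- The nonnegative powers of a rotation by an irrational angle are dense in the circle. -/
theorem Circle.denseRange_exp_pow {α : ℝ} (hα : Irrational (α / (2 * π))) :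
    DenseRange fun n : ℕ => Circle.exp α ^ n := by
  have : Fact (0 < 2 * π) := ⟨two_pi_pos⟩
  have hz : DenseRange fun n : ℤ => n • (α : AddCircle (2 * π)) :=
    AddCircle.denseRange_zsmul_coe_iff.2 hα
  have hn : DenseRange fun n : ℕ => n • (α : AddCircle (2 * π)) :=
    denseRange_zsmul_iff_nsmul.1 hz
  have hs : Function.Surjective (AddCircle.homeomorphCircle' : AddCircle (2 * π) → Circle) :=
    AddCircle.homeomorphCircle'.surjective
  have := hs.denseRange.comp hn AddCircle.homeomorphCircle'.continuous
  convert this using 2 with n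
  rw [Function.comp_apply, ← AddCircle.coe_nsmul, AddCircle.homeomorphCircle'_apply_mk,
    nsmul_eq_mul]
  induction n with
  | zero => simp
  | succ n ih => rw [pow_succ, ih, ← Circle.exp_add]; congr 1; push_cast; ring

/-- A linear map that rotates the plane orthogonal to an axis by an irrational angle has orbits
dense in circles. -/
theorem closure_orbit_of_rotation {m N α : ℝ} (hN : N ^ 2 = m ^ 2 + 1)
    (hα : Irrational (α / (2 * π))) {S : Matrix (Fin 3) (Fin 3) ℝ}
    (hS : ∀ h z, S.mulVec (axisFrame m N h z) = axisFrame m N h (Circle.exp α * z))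
    (v : Fin 3 → ℝ) :
    closure {w : Fin 3 → ℝ | ∃ n : ℕ, w = (S ^ n).mulVec v} =
      {w | w ⬝ᵥ w = v ⬝ᵥ v ∧ w ⬝ᵥ ![-m, 1, 0] = v ⬝ᵥ ![-m, 1, 0]} := by
  have hN0 : N ^ 2 ≠ 0 := by rw [hN]; positivity
  obtain ⟨h, z, rfl⟩ := exists_axisFrame_eq hN v
  have hpow (n : ℕ) : (S ^ n).mulVec (axisFrame m N h z) =
      axisFrame m N h ((Circle.exp α ^ n : Circle) * z) := by
    induction n with
    | zero => simp
    | succ n ih =>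
      rw [pow_succ', ← Matrix.mulVec_mulVec, ih, hS, pow_succ', Circle.coe_mul, mul_assoc]
  apply Set.Subset.antisymm
  · refine closure_minimal ?_ ?_
    · rintro w ⟨n, rfl⟩
      rw [hpow]
      simp only [Set.mem_ofPred_eq, axisFrame_dotProduct_self hN, axisFrame_dotProduct_axis hN,
        norm_mul, Circle.norm_coe, one_mul, and_self]
    · simp only [dotProduct]
      exact (isClosed_eq (by fun_prop) (by fun_prop)).inter
        (isClosed_eq (by fun_prop) (by fun_prop))
  · rintro w ⟨hw, hwa⟩
    obtain ⟨h', z', rfl⟩ := exists_axisFrame_eq hN w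
    rw [axisFrame_dotProduct_axis hN, axisFrame_dotProduct_axis hN] at hwa
    obtain rfl := mul_left_cancel₀ hN0 hwa
    rw [axisFrame_dotProduct_self hN, axisFrame_dotProduct_self hN] at hw
    have hz : ‖z'‖ = ‖z‖ :=
      (sq_eq_sq₀ (norm_nonneg _) (norm_nonneg _)).1 (add_left_cancel (mul_left_cancel₀ hN0 hw))
    obtain ⟨u, rfl⟩ : ∃ u : Circle, z' = u * z := by
      rcases eq_or_ne z 0 with rfl | hz0
      · exact ⟨1, by simpa using hz⟩
      · refine ⟨⟨z' / z, ?_⟩, (div_mul_cancel₀ z' hz0).symm⟩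
        rw [Submonoid.unitSphere, Submonoid.mem_mk, Subsemigroup.mem_mk, mem_sphere_zero_iff_norm, norm_div, hz, div_self (norm_ne_zero_iff.2 hz0)]
    have hcont : Continuous fun u : Circle => axisFrame m N h' (u * z) :=
      (continuous_axisFrame m N h').comp (by fun_prop)
    refine map_mem_closure (f := fun u : Circle => axisFrame m N h' (u * z)) hcont (Circle.denseRange_exp_pow hα u) ?_
    rintro _ ⟨n, rfl⟩
    exact ⟨n, (hpow n).symm⟩

theorem irrational_div_two_pi_of_arccos {α C : ℝ} (hα : cos α = C)
    (hirr : ¬ ∃ q : ℚ, arccos C = (q : ℝ) * π) : Irrational (α / (2 * π)) := by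
  rintro ⟨q, hq⟩
  have hα' : α = 2 * q * π := by rw [hq]; field_simp
  have hcos : cos α = cos (arccos C) := by
    rw [cos_arccos (hα ▸ neg_one_le_cos α) (hα ▸ cos_le_one α), hα]
  obtain ⟨k, hk | hk⟩ := cos_eq_cos_iff.1 hcos
  · exact hirr ⟨2 * k + 2 * q, by rw [hk, hα']; push_cast; ring⟩
  · exact hirr ⟨2 * k - 2 * q, by rw [hk, hα']; push_cast; ring⟩

theorem wedgeS_mulVec_axisFrame {θ N α : ℝ} (hN : N ^ 2 = (√2 * sin (θ / 2)) ^ 2 + 1)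
    (hcos : cos α = (32 / 9) * cos (θ / 2) ^ 4 - (16 / 3) * cos (θ / 2) ^ 2 + 1)
    (hsin : sin α = 4 * √2 * cos (θ / 2) * (3 - 4 * cos (θ / 2) ^ 2) / 9 * N)
    (h : ℝ) (z : ℂ) :
    (wedgeS θ).mulVec (axisFrame (√2 * sin (θ / 2)) N h z) =
      axisFrame (√2 * sin (θ / 2)) N h (Circle.exp α * z) := by
  have hsq : sin (θ / 2) ^ 2 + cos (θ / 2) ^ 2 = 1 := sin_sq_add_cos_sq _
  have h2 : √2 ^ 2 = (2 : ℝ) := sq_sqrt (by norm_num)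
  have hre : (Circle.exp α * z).re = cos α * z.re - sin α * z.im := by
    simp [Circle.coe_exp, Complex.exp_ofReal_mul_I_re, Complex.exp_ofReal_mul_I_im]
  have him : (Circle.exp α * z).im = cos α * z.im + sin α * z.re := by
    simp [Circle.coe_exp, Complex.exp_ofReal_mul_I_re, Complex.exp_ofReal_mul_I_im]
  rw [wedgeS_eq_s16, axisFrame, axisFrame, hre, him, hcos, hsin]
  generalize sin (θ / 2) = s at *
  generalize cos (θ / 2) = c at *
  generalize √2 = r at *
  ext i
  fin_cases i <;>
    simp [Matrix.mulVec, dotProduct, Fin.sum_univ_three, Matrix.one_apply] <;> grind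

/-- If the rotation angle of `S_θ` is not a rational multiple of `π`, then the
closure of the velocity orbit `{S_θⁿ·v : n ∈ ℕ}` is the circle obtained by
intersecting the sphere of radius `‖v‖` with the plane through `v` orthogonal
to the axis of periodicity `a = (−√2 sin(θ/2), 1, 0)`. -/
theorem wedge_velocity_orbit_dense (θ : ℝ) (hθ : θ ∈ Set.Ioo 0 Real.pi)
    (hirr : ¬ ∃ q : ℚ,
      Real.arccos ((32 / 9) * Real.cos (θ / 2) ^ 4
          - (16 / 3) * Real.cos (θ / 2) ^ 2 + 1) = (q : ℝ) * Real.pi)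
    (a : Fin 3 → ℝ) (ha : a = ![-Real.sqrt 2 * Real.sin (θ / 2), 1, 0])
    (v : Fin 3 → ℝ) :
    closure {w : Fin 3 → ℝ | ∃ n : ℕ, w = (wedgeS θ ^ n).mulVec v} =
      {w : Fin 3 → ℝ | dotProduct w w = dotProduct v v ∧
        dotProduct w a = dotProduct v a} := by
  have hsq : sin (θ / 2) ^ 2 + cos (θ / 2) ^ 2 = 1 := sin_sq_add_cos_sq _
  have h2 : √2 ^ 2 = (2 : ℝ) := sq_sqrt (by norm_num)
  have hc : 0 ≤ cos (θ / 2) :=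
    cos_nonneg_of_mem_Icc ⟨by linarith [hθ.1, pi_pos], by linarith [hθ.2]⟩
  set m := √2 * sin (θ / 2) with hm
  have hN : √(m ^ 2 + 1) ^ 2 = m ^ 2 + 1 := sq_sqrt (by positivity)
  set β := arccos ((3 - 4 * cos (θ / 2) ^ 2) / 3) with hβ
  have hcosβ : cos β = (3 - 4 * cos (θ / 2) ^ 2) / 3 :=
    cos_arccos (by nlinarith [sq_nonneg (sin (θ / 2))]) (by nlinarith)
  have hsinβ : sin β = 2 * √2 * cos (θ / 2) * √(m ^ 2 + 1) / 3 := by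
    rw [← sq_eq_sq₀ (sin_nonneg_of_nonneg_of_le_pi (arccos_nonneg _) (arccos_le_pi _))
      (by positivity), sin_sq, hcosβ]
    grind
  have hcos : cos (2 * β) =
      (32 / 9) * cos (θ / 2) ^ 4 - (16 / 3) * cos (θ / 2) ^ 2 + 1 := by
    rw [cos_two_mul, hcosβ]; ring
  have hsin : sin (2 * β) =
      4 * √2 * cos (θ / 2) * (3 - 4 * cos (θ / 2) ^ 2) / 9 * √(m ^ 2 + 1) := by
    rw [sin_two_mul, hcosβ, hsinβ]; ring
  have ha' : a = ![-m, 1, 0] := by rw [ha, hm, neg_mul]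
  rw [ha']
  exact closure_orbit_of_rotation hN (irrational_div_two_pi_of_arccos hcos hirr)
    (wedgeS_mulVec_axisFrame hN hcos hsin) v
end

section
/- Let v₀ ∈ ℝ³ be a unit vector (v₀·v₀ = 1) with (v₀)₂ > 0, and define the orbit sequences v, q : ℕ → ℝ³ of the no-slip strip billiard by v_{n+1} = T'·v_n when n is even, v_{n+1} = T·v_n when n is odd, and q_{n+1} = q_n + (1/(v₀)₂)·v_n with (q₀)₂ = 0. Then there is no index n ∈ ℕ such that the four consecutive horizontal components (v_n)₁, (v_{n+1})₁, (v_{n+2})₁, (v_{n+3})₁ are all strictly positive, and likewise none such that they are all strictly negative; i.e., the no-slip strip billiard can never have more than three consecutive trajectory segments in the same horizontal direction. -/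
open Real Matrix

/-- `D = diag(1, -1, -1)`. -/
noncomputable def noslipD : Matrix (Fin 3) (Fin 3) ℝ :=
  !![1, 0, 0; 0, -1, 0; 0, 0, -1]

/-- The no-slip collision matrix `T' = D·T·D` at the upper wall `{x₂ = 1}`. -/
noncomputable def noslipT' : Matrix (Fin 3) (Fin 3) ℝ :=
  noslipD * noslipT * noslipD

/-- The horizontal components along an orbit satisfy a three-term linear recursion. -/
theorem noslip_horizontal_recursion (v : ℕ → Fin 3 → ℝ)
    (hv : ∀ n, v (n + 1) = if Even n then noslipT'.mulVec (v n)
                           else noslipT.mulVec (v n)) (n : ℕ) :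
    v (n + 2) 1 = 2 / 3 * v (n + 1) 1 - v n 1 := by
  have hs : √(2 : ℝ) ^ 2 = 2 := Real.sq_sqrt (by norm_num)
  have hT (w : Fin 3 → ℝ) : noslipT.mulVec w 0 = -1 / 3 * w 0 + 2 * √2 / 3 * w 1 ∧
      noslipT.mulVec w 1 = 2 * √2 / 3 * w 0 + 1 / 3 * w 1 := by
    constructor <;> simp [noslipT, Matrix.mulVec, dotProduct, Fin.sum_univ_three]
  have hT' (w : Fin 3 → ℝ) : noslipT'.mulVec w 0 = -1 / 3 * w 0 - 2 * √2 / 3 * w 1 ∧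
      noslipT'.mulVec w 1 = -(2 * √2 / 3) * w 0 + 1 / 3 * w 1 := by
    constructor <;>
      simp [noslipT', noslipT, noslipD, Matrix.mul_apply, Matrix.mulVec, dotProduct,
        Fin.sum_univ_three] <;> ring
  rw [hv (n + 1), hv n]
  by_cases hn : Even n
  · rw [if_pos hn, if_neg (by simpa [Nat.even_add_one] using hn), (hT _).2, (hT' _).1, (hT' _).2]
    linear_combination (-4 / 9 * v n 1) * hs
  · rw [if_neg hn, if_pos (by simpa [Nat.even_add_one] using hn), (hT' _).2, (hT _).1, (hT _).2]
    linear_combination (-4 / 9 * v n 1) * hs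

/-- The no-slip strip billiard can never have more than three consecutive
trajectory segments in the same horizontal direction: no four consecutive
post-collision velocities have all-positive (or all-negative) horizontal
components. -/
theorem noslip_strip_no_four_consecutive (v₀ : Fin 3 → ℝ)
    (hunit : v₀ 0 ^ 2 + v₀ 1 ^ 2 + v₀ 2 ^ 2 = 1) (hv2 : 0 < v₀ 2)
    (v q : ℕ → Fin 3 → ℝ)
    (hv0 : v 0 = v₀) (hq0 : q 0 2 = 0)
    (hv : ∀ n, v (n + 1) = if Even n then noslipT'.mulVec (v n)
                           else noslipT.mulVec (v n))
    (hq : ∀ n, q (n + 1) = q n + (1 / v₀ 2) • v n) :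
    (¬ ∃ n : ℕ, 0 < v n 1 ∧ 0 < v (n + 1) 1 ∧ 0 < v (n + 2) 1 ∧
        0 < v (n + 3) 1) ∧
      ¬ ∃ n : ℕ, v n 1 < 0 ∧ v (n + 1) 1 < 0 ∧ v (n + 2) 1 < 0 ∧
        v (n + 3) 1 < 0 := by
  have h (n : ℕ) : v n 1 + v (n + 3) 1 = -(1 / 3) * (v (n + 1) 1 + v (n + 2) 1) := by
    linarith [noslip_horizontal_recursion v hv n, noslip_horizontal_recursion v hv (n + 1)]
  constructor <;> rintro ⟨n, h0, h1, h2, h3⟩ <;> linarith [h n]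
end
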